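/- Let a C¹-spacetime on ℝⁿ be causally non-branching and non-intertwining. Then for every p ∈ ℝⁿ the causal exponential map exp_p : 𝔈_p → ℝⁿ is continuous (where 𝔈_p ⊆ ℝⁿ carries the subspace topology). -/

import Mathlib

open Set Filter Topology MeasureTheory
open scoped ENNReal NNReal

noncomputable section

/-- Points of ℝⁿ. -/
abbrev SpacetimePt (n : ℕ) := Fin n → ℝ

/-- Evaluation of a bilinear form given by a coefficient matrix. -/
def bilForm {n : ℕ} (g : Fin n → Fin n → ℝ) (u v : Fin n → ℝ) : ℝ :=
  ∑ i, ∑ j, g i j * u i * v j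

/-- The Minkowski matrix diag(−1,1,…,1). -/
def minkowskiMatrix (n : ℕ) : Fin n → Fin n → ℝ := fun i j =>
  if i = j then (if (i : ℕ) = 0 then -1 else 1) else 0

/-- A time-oriented C¹-spacetime on ℝⁿ: a C¹ family of symmetric bilinear forms of
Lorentzian signature (−,+,…,+), together with a continuous timelike vector field. -/
structure C1Spacetime (n : ℕ) where
  g : SpacetimePt n → Fin n → Fin n → ℝ
  g_contDiff : ContDiff ℝ 1 g
  g_symm : ∀ p i j, g p i j = g p j i
  g_lorentz : ∀ p : SpacetimePt n, ∃ L : (Fin n → ℝ) ≃ₗ[ℝ] (Fin n → ℝ),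
    ∀ i j, bilForm (g p) (L (Pi.single i 1)) (L (Pi.single j 1)) = minkowskiMatrix n i j
  X0 : SpacetimePt n → Fin n → ℝ
  X0_cont : Continuous X0
  X0_timelike : ∀ p, bilForm (g p) (X0 p) (X0 p) < 0

namespace C1Spacetime

variable {n : ℕ} (M : C1Spacetime n)

/-- The inverse metric. -/
def ginv (p : SpacetimePt n) : Matrix (Fin n) (Fin n) ℝ :=
  (Matrix.of (M.g p))⁻¹

/-- Christoffel symbols Γᵏᵢⱼ = ½ Σ_l gᵏˡ(∂ᵢ g_{jl} + ∂ⱼ g_{il} − ∂_l g_{ij}). -/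
def christoffel (k i j : Fin n) (p : SpacetimePt n) : ℝ :=
  (1 / 2) * ∑ l, M.ginv p k l *
    (fderiv ℝ (fun q => M.g q j l) p (Pi.single i 1)
      + fderiv ℝ (fun q => M.g q i l) p (Pi.single j 1)
      - fderiv ℝ (fun q => M.g q i j) p (Pi.single l 1))

/-- A geodesic on the interval `I` : a C² curve satisfying the geodesic equation. -/
def IsGeodesicOn (γ : ℝ → SpacetimePt n) (I : Set ℝ) : Prop :=
  ContDiffOn ℝ 2 γ I ∧ ∀ t ∈ I, ∀ k,
    derivWithin (fun s => derivWithin γ I s k) I t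
      + ∑ i, ∑ j, M.christoffel k i j (γ t) *
          derivWithin γ I t i * derivWithin γ I t j = 0

/-- `v` is a causal vector at `p`. -/
def CausalVec (p v : SpacetimePt n) : Prop := v ≠ 0 ∧ bilForm (M.g p) v v ≤ 0

/-- `v` is a timelike vector at `p`. -/
def TimelikeVec (p v : SpacetimePt n) : Prop := bilForm (M.g p) v v < 0

/-- A causal vector `v` at `p` is future-directed. -/
def FdVec (p v : SpacetimePt n) : Prop := bilForm (M.g p) v (M.X0 p) < 0

/-- A causal vector `v` at `p` is past-directed. -/
def PdVec (p v : SpacetimePt n) : Prop := 0 < bilForm (M.g p) v (M.X0 p)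

/-- A causal geodesic on `I`: the velocity is everywhere causal. -/
def IsCausalGeodesicOn (γ : ℝ → SpacetimePt n) (I : Set ℝ) : Prop :=
  M.IsGeodesicOn γ I ∧ ∀ t ∈ I, M.CausalVec (γ t) (derivWithin γ I t)

/-- A future-directed causal geodesic on `I`. -/
def IsFdCausalGeodesicOn (γ : ℝ → SpacetimePt n) (I : Set ℝ) : Prop :=
  M.IsGeodesicOn γ I ∧ ∀ t ∈ I,
    M.CausalVec (γ t) (derivWithin γ I t) ∧ M.FdVec (γ t) (derivWithin γ I t)

/-- A past-directed causal geodesic on `I`. -/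
def IsPdCausalGeodesicOn (γ : ℝ → SpacetimePt n) (I : Set ℝ) : Prop :=
  M.IsGeodesicOn γ I ∧ ∀ t ∈ I,
    M.CausalVec (γ t) (derivWithin γ I t) ∧ M.PdVec (γ t) (derivWithin γ I t)

/-- A geodesic `γ : [a,b] → ℝⁿ` branches at `t₀ ∈ (a,b)`. -/
def BranchesAt (γ : ℝ → SpacetimePt n) (a b t₀ : ℝ) : Prop :=
  ∃ ε > 0, a ≤ t₀ - ε ∧ t₀ + ε ≤ b ∧
    ∃ σ : ℝ → SpacetimePt n, M.IsGeodesicOn σ (Ioo (t₀ - ε) (t₀ + ε)) ∧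
      (∀ t ∈ Ioc (t₀ - ε) t₀, γ t = σ t) ∧
      (γ '' Ioo t₀ (t₀ + ε)) ∩ (σ '' Ioo t₀ (t₀ + ε)) = ∅

/-- No causal geodesic branches. -/
def CausallyNonBranching : Prop :=
  ∀ (γ : ℝ → SpacetimePt n) (a b : ℝ), a < b → M.IsCausalGeodesicOn γ (Icc a b) →
    ∀ t₀ ∈ Ioo a b, ¬ M.BranchesAt γ a b t₀

/-- Non-intertwining. -/
def NonIntertwining : Prop :=
  ∀ p : SpacetimePt n, ∃ U ∈ 𝓝 p, ∀ ε : ℝ, 0 < ε → ∀ γ₁ γ₂ : ℝ → SpacetimePt n,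
    M.IsCausalGeodesicOn γ₁ (Icc 0 ε) → M.IsCausalGeodesicOn γ₂ (Icc 0 ε) →
    (∀ t ∈ Icc (0:ℝ) ε, γ₁ t ∈ U) → (∀ t ∈ Icc (0:ℝ) ε, γ₂ t ∈ U) →
    γ₁ 0 = p → γ₂ 0 = p →
    derivWithin γ₁ (Icc 0 ε) 0 = derivWithin γ₂ (Icc 0 ε) 0 →
    (∀ t ∈ Icc (0:ℝ) ε, γ₁ t = γ₂ t) ∨
      ¬ ∃ z : SpacetimePt n, AccPt z (𝓟 ((γ₁ '' Ioc 0 ε) ∩ (γ₂ '' Ioc 0 ε)))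

/-- Domain of the causal exponential map at `p`. -/
def ExpDomain (p : SpacetimePt n) : Set (SpacetimePt n) :=
  {v | bilForm (M.g p) v v ≤ 0 ∧
    ∃ γ : ℝ → SpacetimePt n, M.IsCausalGeodesicOn γ (Icc 0 1) ∧ γ 0 = p ∧
      derivWithin γ (Icc 0 1) 0 = v}

/-- A future-directed causal path on the interval `I`: locally Lipschitz with almost
everywhere future-directed causal derivative. -/
def IsFdCausalPathOn (γ : ℝ → SpacetimePt n) (I : Set ℝ) : Prop :=
  I.OrdConnected ∧ I.Nonempty ∧
    (∀ t ∈ I, ∃ K : ℝ≥0, ∃ U ∈ 𝓝[I] t, LipschitzOnWith K γ U) ∧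
    ∀ᵐ t ∂(volume.restrict I), DifferentiableAt ℝ γ t ∧
      M.CausalVec (γ t) (deriv γ t) ∧ M.FdVec (γ t) (deriv γ t)

/-- A future-directed timelike path on the interval `I`. -/
def IsFdTimelikePathOn (γ : ℝ → SpacetimePt n) (I : Set ℝ) : Prop :=
  I.OrdConnected ∧ I.Nonempty ∧
    (∀ t ∈ I, ∃ K : ℝ≥0, ∃ U ∈ 𝓝[I] t, LipschitzOnWith K γ U) ∧
    ∀ᵐ t ∂(volume.restrict I), DifferentiableAt ℝ γ t ∧
      M.TimelikeVec (γ t) (deriv γ t) ∧ M.FdVec (γ t) (deriv γ t)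

/-- Chronological relation `p ≪ q`. -/
def chron (p q : SpacetimePt n) : Prop :=
  ∃ (γ : ℝ → SpacetimePt n) (a b : ℝ), a < b ∧ M.IsFdTimelikePathOn γ (Icc a b) ∧
    γ a = p ∧ γ b = q

/-- Causal relation `p ≤ q`. -/
def causalLe (p q : SpacetimePt n) : Prop :=
  p = q ∨ ∃ (γ : ℝ → SpacetimePt n) (a b : ℝ), a < b ∧ M.IsFdCausalPathOn γ (Icc a b) ∧
    γ a = p ∧ γ b = q

/-- g-length of a causal path on `[a,b]`. -/
def gLength (γ : ℝ → SpacetimePt n) (a b : ℝ) : ℝ :=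
  ∫ t in a..b, Real.sqrt (- bilForm (M.g (γ t)) (deriv γ t) (deriv γ t))

/-- Lorentzian distance. -/
def ldist (p q : SpacetimePt n) : ℝ≥0∞ :=
  ⨆ (γ : ℝ → SpacetimePt n) (a : ℝ) (b : ℝ) (_ : a < b)
    (_ : M.IsFdCausalPathOn γ (Icc a b)) (_ : γ a = p) (_ : γ b = q),
    ENNReal.ofReal (M.gLength γ a b)

/-- Non-total imprisonment: no future or past inextendible causal curve is contained
in a compact set (inextendible = no limit at the open end). -/
def NonImprisoning : Prop :=
  ∀ K : Set (SpacetimePt n), IsCompact K →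
    (∀ (a b : ℝ) (γ : ℝ → SpacetimePt n), M.IsFdCausalPathOn γ (Ico a b) →
      (¬ ∃ q, Tendsto γ (𝓝[<] b) (𝓝 q)) → ¬ ∀ t ∈ Ico a b, γ t ∈ K) ∧
    (∀ (a : ℝ) (γ : ℝ → SpacetimePt n), M.IsFdCausalPathOn γ (Ici a) →
      (¬ ∃ q, Tendsto γ atTop (𝓝 q)) → ¬ ∀ t ∈ Ici a, γ t ∈ K) ∧
    (∀ (a b : ℝ) (γ : ℝ → SpacetimePt n), M.IsFdCausalPathOn γ (Ioc a b) →
      (¬ ∃ q, Tendsto γ (𝓝[>] a) (𝓝 q)) → ¬ ∀ t ∈ Ioc a b, γ t ∈ K) ∧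
    (∀ (b : ℝ) (γ : ℝ → SpacetimePt n), M.IsFdCausalPathOn γ (Iic b) →
      (¬ ∃ q, Tendsto γ atBot (𝓝 q)) → ¬ ∀ t ∈ Iic b, γ t ∈ K)

/-- Global hyperbolicity. -/
def GloballyHyperbolic : Prop :=
  M.NonImprisoning ∧
    ∀ p q : SpacetimePt n, IsCompact {z : SpacetimePt n | M.causalLe p z ∧ M.causalLe z q}

/-- Finite compactness. -/
def FinitelyCompact : Prop :=
  ∀ B : ℝ, 0 < B → ∀ p q : SpacetimePt n, ∀ x : ℕ → SpacetimePt n,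
    ((∀ m, M.chron p q ∧ M.causalLe q (x m) ∧ M.ldist p (x m) ≤ ENNReal.ofReal B) →
      ∃ z : SpacetimePt n, MapClusterPt z atTop x) ∧
    ((∀ m, M.causalLe (x m) q ∧ M.chron q p ∧ M.ldist (x m) p ≤ ENNReal.ofReal B) →
      ∃ z : SpacetimePt n, MapClusterPt z atTop x)

/-- Timelike Cauchy completeness. -/
def TimelikeCauchyComplete : Prop :=
  ∀ (x : ℕ → SpacetimePt n) (B : ℕ → ℝ), (∀ m, 0 ≤ B m) → Tendsto B atTop (𝓝 0) →
    (((∀ m, M.chron (x m) (x (m + 1))) ∧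
        ∀ k m : ℕ, 0 < m → M.ldist (x k) (x (k + m)) ≤ ENNReal.ofReal (B k)) ∨
      ((∀ m, M.chron (x (m + 1)) (x m)) ∧
        ∀ k m : ℕ, 0 < m → M.ldist (x (k + m)) (x k) ≤ ENNReal.ofReal (B k))) →
    ∃ l : SpacetimePt n, Tendsto x atTop (𝓝 l)

/-- Condition A for C¹-spacetimes: for `x ≪ y` and every future inextendible
future-directed causal geodesic starting at `y` defined on `[0,c)` (`c ∈ (0,∞]`),
the Lorentzian distance `T(x, γ(t))` tends to infinity as `t → c`; dually for the past. -/
def ConditionA : Prop :=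
  (∀ x y : SpacetimePt n, M.chron x y →
    (∀ c : ℝ, 0 < c → ∀ γ : ℝ → SpacetimePt n, M.IsFdCausalGeodesicOn γ (Ico 0 c) →
      γ 0 = y → (¬ ∃ z, Tendsto γ (𝓝[<] c) (𝓝 z)) →
      Tendsto (fun t => M.ldist x (γ t)) (𝓝[<] c) (𝓝 ⊤)) ∧
    (∀ γ : ℝ → SpacetimePt n, M.IsFdCausalGeodesicOn γ (Ici 0) →
      γ 0 = y → (¬ ∃ z, Tendsto γ atTop (𝓝 z)) →
      Tendsto (fun t => M.ldist x (γ t)) atTop (𝓝 ⊤))) ∧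
  (∀ x y : SpacetimePt n, M.chron y x →
    (∀ c : ℝ, 0 < c → ∀ γ : ℝ → SpacetimePt n, M.IsPdCausalGeodesicOn γ (Ico 0 c) →
      γ 0 = y → (¬ ∃ z, Tendsto γ (𝓝[<] c) (𝓝 z)) →
      Tendsto (fun t => M.ldist (γ t) x) (𝓝[<] c) (𝓝 ⊤)) ∧
    (∀ γ : ℝ → SpacetimePt n, M.IsPdCausalGeodesicOn γ (Ici 0) →
      γ 0 = y → (¬ ∃ z, Tendsto γ atTop (𝓝 z)) →
      Tendsto (fun t => M.ldist (γ t) x) atTop (𝓝 ⊤)))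

end C1Spacetime

section ODE

variable {E : Type*} [NormedAddCommGroup E] [NormedSpace ℝ E]

/-- `z` is an integral curve of the autonomous vector field `F` on `[0, T]`. -/
def IsSolOn (F : E → E) (z : ℝ → E) (T : ℝ) : Prop :=
  ∀ t ∈ Icc 0 T, HasDerivWithinAt z (F (z t)) (Icc 0 T) t

theorem IsSolOn.mono {F : E → E} {z : ℝ → E} {T a : ℝ} (h : IsSolOn F z T) (ha : a ≤ T) :
    IsSolOn F z a := fun t ht =>
  (h t ⟨ht.1, ht.2.trans ha⟩).mono (Icc_subset_Icc_right ha)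

/-- A solution staying in a set where `F` is bounded by `L` is `L`-Lipschitz. -/
theorem IsSolOn.norm_sub_le {F : E → E} {z : ℝ → E} {T L : ℝ} {K : Set E} (h : IsSolOn F z T)
    (hK : ∀ t ∈ Icc 0 T, z t ∈ K) (hL : ∀ x ∈ K, ‖F x‖ ≤ L) {s t : ℝ} (hs : s ∈ Icc 0 T)
    (ht : t ∈ Icc 0 T) : ‖z s - z t‖ ≤ L * |s - t| := by
  simpa using (convex_Icc 0 T).norm_image_sub_le_of_norm_hasDerivWithin_le h
    (fun x hx => hL _ (hK x hx)) ht hs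

/-- Quantitative first-order expansion of a solution. -/
theorem IsSolOn.norm_sub_sub_le {F : E → E} {z : ℝ → E} {T L ε δ : ℝ} {K : Set E}
    (h : IsSolOn F z T) (hK : ∀ t ∈ Icc 0 T, z t ∈ K) (hL : ∀ x ∈ K, ‖F x‖ ≤ L) (hL0 : 0 < L)
    (hF : ∀ x ∈ K, ∀ y ∈ K, dist x y < δ → dist (F x) (F y) < ε) {s t : ℝ} (hs : s ∈ Icc 0 T)
    (ht : t ∈ Icc 0 T) (hst : |s - t| < δ / L) :
    ‖z s - z t - (s - t) • F (z t)‖ ≤ ε * |s - t| := by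
  have hsub : uIcc t s ⊆ Icc 0 T := (convex_Icc 0 T).ordConnected.uIcc_subset ht hs
  have key := (convex_uIcc t s).norm_image_sub_le_of_norm_hasDerivWithin_le
    (f := fun u => z u - u • F (z t)) (f' := fun u => F (z u) - F (z t)) (C := ε)
    (fun u hu => by
      have h1 := ((h u (hsub hu)).mono hsub).sub
        ((hasDerivWithinAt_id u (uIcc t s)).smul_const (F (z t)))
      rw [one_smul] at h1
      exact h1)
    (fun u hu => by
      rw [← dist_eq_norm]
      refine (hF _ (hK _ (hsub hu)) _ (hK _ ht) ?_).le
      rw [dist_eq_norm]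
      refine (h.norm_sub_le hK hL (hsub hu) ht).trans_lt ?_
      have h2 : |u - t| ≤ |s - t| := abs_sub_left_of_mem_uIcc hu
      calc L * |u - t| ≤ L * |s - t| := by gcongr
        _ < L * (δ / L) := by gcongr
        _ = δ := by field_simp)
    left_mem_uIcc right_mem_uIcc
  have e : z s - z t - (s - t) • F (z t) = z s - s • F (z t) - (z t - t • F (z t)) := by
    rw [sub_smul]; abel
  rw [e]
  simpa using key

/-- An ultrafilter limit of solutions staying in a compact set is a solution. -/
theorem exists_isSolOn_of_eventually_mem {ι : Type*} (U : Ultrafilter ι) {F : E → E}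
    (hF : Continuous F) {y : ι → ℝ → E} {a : ℝ} (hy : ∀ i, IsSolOn F (y i) a) {K : Set E}
    (hK : IsCompact K) (hyK : ∀ᶠ i in U, ∀ t ∈ Icc 0 a, y i t ∈ K) :
    ∃ z : ℝ → E, IsSolOn F z a ∧
      ∀ t ∈ Icc 0 a, Tendsto (fun i => y i t) U (𝓝 (z t)) := by
  have hex : ∀ t, ∃ x, t ∈ Icc 0 a → Tendsto (fun i => y i t) U (𝓝 x) := by
    intro t
    by_cases ht : t ∈ Icc 0 a
    · obtain ⟨x, -, hx⟩ := hK.ultrafilter_le_nhds (U.map fun i => y i t)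
        (le_principal_iff.2 (hyK.mono fun i hi => hi t ht))
      exact ⟨x, fun _ => hx⟩
    · exact ⟨0, fun h => absurd h ht⟩
  choose z hz using hex
  refine ⟨z, fun t ht => ?_, hz⟩
  obtain ⟨L', hL'⟩ := hK.exists_bound_of_continuousOn hF.continuousOn
  set L := max L' 1
  have hL : ∀ x ∈ K, ‖F x‖ ≤ L := fun x hx => (hL' x hx).trans (le_max_left _ _)
  have hL0 : 0 < L := lt_max_of_lt_right one_pos
  rw [hasDerivWithinAt_iff_isLittleO, Asymptotics.isLittleO_iff]
  intro ε hε
  obtain ⟨δ, hδ, hδF⟩ := Metric.uniformContinuousOn_iff.1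
    (hK.uniformContinuousOn_of_continuous hF.continuousOn) ε hε
  have hnear : ∀ᶠ s in 𝓝[Icc 0 a] t, |s - t| < δ / L :=
    nhdsWithin_le_nhds (Metric.ball_mem_nhds t (by positivity))
  filter_upwards [hnear, self_mem_nhdsWithin] with s hs hsa
  have hlim : Tendsto (fun i => ‖y i s - y i t - (s - t) • F (y i t)‖) U
      (𝓝 ‖z s - z t - (s - t) • F (z t)‖) :=
    (((hz s hsa).sub (hz t ht)).sub
      (((hF.tendsto _).comp (hz t ht)).const_smul (s - t))).norm
  exact le_of_tendsto hlim (hyK.mono fun i hi =>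
    (hy i).norm_sub_sub_le hi hL hL0 hδF hsa ht hs)

/-- Continuous dependence on initial values at a solution `Γ` that is unique among the solutions
in the closed set `C` which stay `r`-close to `Γ`. -/
theorem tendsto_solution_of_unique [ProperSpace E] {ι : Type*} (U : Ultrafilter ι) {F : E → E}
    (hF : Continuous F) {C : Set E} (hC : IsClosed C) {Γ : ℝ → E}
    (hΓ : ContinuousOn Γ (Icc 0 1)) {y : ι → ℝ → E} (hy : ∀ i, IsSolOn F (y i) 1)
    (hyC : ∀ i, ∀ t ∈ Icc (0 : ℝ) 1, y i t ∈ C) (h0 : Tendsto (fun i => y i 0) U (𝓝 (Γ 0)))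
    {r : ℝ} (hr : 0 < r)
    (huniq : ∀ T ∈ Ioc (0 : ℝ) 1, ∀ z, IsSolOn F z T →
      (∀ t ∈ Icc 0 T, z t ∈ C ∧ dist (z t) (Γ t) ≤ r) → z 0 = Γ 0 → z T = Γ T) :
    Tendsto (fun i => y i 1) U (𝓝 (Γ 1)) := by
  set K := Metric.cthickening r (Γ '' Icc 0 1)
  have hK : IsCompact K := (isCompact_Icc.image_of_continuousOn hΓ).cthickening
  have hmemK : ∀ t ∈ Icc (0 : ℝ) 1, ∀ x, dist x (Γ t) ≤ r → x ∈ K := fun t ht x hx =>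
    Metric.mem_cthickening_of_dist_le x (Γ t) r _ (mem_image_of_mem _ ht) hx
  have limit_eq : ∀ a ∈ Icc (0 : ℝ) 1,
      (∀ᶠ i in U, ∀ t ∈ Icc 0 a, dist (y i t) (Γ t) ≤ r) →
      Tendsto (fun i => y i a) U (𝓝 (Γ a)) := by
    intro a ha hclose
    rcases ha.1.eq_or_lt with rfl | ha0
    · exact h0
    have hsub : Icc 0 a ⊆ Icc 0 1 := Icc_subset_Icc_right ha.2
    obtain ⟨z, hz, hlim⟩ := exists_isSolOn_of_eventually_mem U hF (fun i => (hy i).mono ha.2) hK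
      (hclose.mono fun i hi t ht => hmemK t (hsub ht) _ (hi t ht))
    rw [← huniq a ⟨ha0, ha.2⟩ z hz
      (fun t ht => ⟨hC.mem_of_tendsto (hlim t ht) (Eventually.of_forall fun i => hyC i t (hsub ht)),
        le_of_tendsto ((hlim t ht).dist tendsto_const_nhds) (hclose.mono fun i hi => hi t ht)⟩)
      (tendsto_nhds_unique (hlim 0 ⟨le_rfl, ha.1⟩) h0)]
    exact hlim a ⟨ha.1, le_rfl⟩
  obtain ⟨L', hL'⟩ := hK.exists_bound_of_continuousOn hF.continuousOn
  set L := max L' 0 + 1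
  have hL : ∀ x ∈ K, ‖F x‖ < L := fun x hx =>
    ((hL' x hx).trans (le_max_left _ _)).trans_lt (lt_add_one _)
  have hL0 : 0 < L := by positivity
  obtain ⟨δ, hδ, hδΓ⟩ := Metric.uniformContinuousOn_iff.1
    (isCompact_Icc.uniformContinuousOn_of_continuous hΓ) (r / 4) (by positivity)
  obtain ⟨N, hN⟩ := exists_nat_gt (max (1 / δ) (L / (r / 4)))
  have hN0 : (0 : ℝ) < N := lt_of_lt_of_le' hN (le_max_of_le_left (by positivity))
  have hNδ : 1 / (N : ℝ) < δ := by
    rw [one_div_lt hN0 hδ]; exact (le_max_left _ _).trans_lt hN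
  have hNL : L * (1 / (N : ℝ)) < r / 4 := by
    have h1 := (le_max_right _ _).trans_lt hN
    rw [div_lt_iff₀ (by positivity)] at h1
    rw [mul_one_div, div_lt_iff₀ hN0]; linarith
  have extend : ∀ k : ℕ, k ≤ N →
      ∀ᶠ i in U, ∀ t ∈ Icc 0 ((k : ℝ) / N), dist (y i t) (Γ t) ≤ r := by
    intro k
    induction k with
    | zero =>
      intro _
      filter_upwards [h0.eventually (Metric.closedBall_mem_nhds _ hr)] with i hi t ht
      obtain rfl : t = 0 := by simpa using ht
      exact hi
    | succ k ih =>
      intro hk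
      have ihk := ih (by omega)
      have hk1 : (k : ℝ) + 1 ≤ N := by exact_mod_cast hk
      have ha : (k : ℝ) / N ∈ Icc (0 : ℝ) 1 :=
        ⟨by positivity, by rw [div_le_one hN0]; linarith⟩
      have hb : ((k + 1 : ℕ) : ℝ) / N = k / N + 1 / N := by push_cast; ring
      have hb1 : ((k + 1 : ℕ) : ℝ) / N ≤ 1 := by rw [div_le_one hN0]; exact_mod_cast hk
      rw [hb] at hb1 ⊢
      set a := (k : ℝ) / N
      filter_upwards [ihk, (limit_eq a ha ihk).eventually
        (Metric.closedBall_mem_nhds _ (half_pos hr))] with i hi hia t ht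
      rcases le_or_gt t a with hta | hta
      · exact hi t ⟨ht.1, hta⟩
      have hia : dist (y i a) (Γ a) ≤ r / 2 := hia
      have hsub : Icc a (a + 1 / N) ⊆ Icc 0 1 := Icc_subset_Icc ha.1 hb1
      have bound := image_norm_le_of_norm_deriv_right_lt_deriv_boundary
        (f := fun s => y i s - y i a) (f' := fun s => F (y i s)) (a := a) (b := a + 1 / N)
        (B := fun s => L * (s - a)) (B' := fun _ => L)
        (fun s hs => (((hy i) s (hsub hs)).continuousWithinAt.mono hsub).sub
          continuousWithinAt_const)
        (fun s hs => by
          have hs1 : s < 1 := hs.2.trans_le hb1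
          have hs0 : 0 ≤ s := ha.1.trans hs.1
          exact ((((hy i) s ⟨hs0, hs1.le⟩).mono_of_mem_nhdsWithin
            (mem_of_superset (Icc_mem_nhdsGE hs1) (Icc_subset_Icc_left hs0)))).sub_const _)
        (by simp)
        (fun s => by simpa using ((hasDerivAt_id s).sub_const a).const_mul L)
        (fun s hs hsB => by
          refine hL _ (hmemK a ha _ ?_)
          have h1 : L * (s - a) ≤ L * (1 / N) := by gcongr; linarith [hs.2]
          have h2 : dist (y i s) (y i a) = L * (s - a) := by rw [dist_eq_norm]; exact hsB
          linarith [dist_triangle (y i s) (y i a) (Γ a)])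
        (x := t) ⟨hta.le, ht.2⟩
      have h1 : L * (t - a) ≤ L * (1 / N) := by gcongr; linarith [ht.2]
      have h2 : dist (y i t) (y i a) ≤ L * (t - a) := by rw [dist_eq_norm]; exact bound
      have h3 : dist (Γ a) (Γ t) < r / 4 := by
        refine hδΓ a ha t (hsub ⟨hta.le, ht.2⟩) ?_
        rw [dist_comm, Real.dist_eq, abs_of_pos (sub_pos.2 hta)]
        linarith [ht.2]
      linarith [dist_triangle4 (y i t) (y i a) (Γ a) (Γ t)]
  refine limit_eq 1 ⟨zero_le_one, le_rfl⟩ ?_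
  simpa [div_self hN0.ne'] using extend N le_rfl

theorem hasDerivWithinAt_fst_comp {E' : Type*} [NormedAddCommGroup E'] [NormedSpace ℝ E']
    {z : ℝ → E × E'} {z' : E × E'} {s : Set ℝ} {t : ℝ} (h : HasDerivWithinAt z z' s t) :
    HasDerivWithinAt (fun u => (z u).1) z'.1 s t :=
  (ContinuousLinearMap.fst ℝ E E').hasFDerivAt.comp_hasDerivWithinAt t h

theorem hasDerivWithinAt_snd_comp {E' : Type*} [NormedAddCommGroup E'] [NormedSpace ℝ E']
    {z : ℝ → E × E'} {z' : E × E'} {s : Set ℝ} {t : ℝ} (h : HasDerivWithinAt z z' s t) :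
    HasDerivWithinAt (fun u => (z u).2) z'.2 s t :=
  (ContinuousLinearMap.snd ℝ E E').hasFDerivAt.comp_hasDerivWithinAt t h

end ODE

namespace C1Spacetime

variable {n : ℕ} (M : C1Spacetime n)

theorem det_g_ne_zero (p : SpacetimePt n) : (Matrix.of (M.g p)).det ≠ 0 := by
  obtain ⟨L, hL⟩ := M.g_lorentz p
  set P := LinearMap.toMatrix' (L : (Fin n → ℝ) →ₗ[ℝ] (Fin n → ℝ)) with hP
  have h : P.transpose * Matrix.of (M.g p) * P =
      Matrix.diagonal fun i : Fin n => if (i : ℕ) = 0 then (-1 : ℝ) else 1 := by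
    ext i j
    have := hL i j
    rw [minkowskiMatrix] at this
    rw [Matrix.diagonal_apply, ← this]
    simp only [Matrix.mul_apply, bilForm, Matrix.transpose_apply, hP, LinearMap.toMatrix'_apply,
      Finset.sum_mul, Matrix.of_apply]
    rw [Finset.sum_comm]
    refine Finset.sum_congr rfl fun a _ => Finset.sum_congr rfl fun b _ => ?_
    simp only [LinearEquiv.coe_coe]
    ring
  intro h0
  have hdet := congrArg Matrix.det h
  rw [Matrix.det_mul, Matrix.det_mul, h0, Matrix.det_diagonal] at hdet
  simp only [mul_zero, zero_mul] at hdet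
  refine Finset.prod_ne_zero_iff.2 (fun i _ => ?_) hdet.symm
  split_ifs <;> norm_num

theorem continuous_g_apply (i j : Fin n) : Continuous fun p => M.g p i j :=
  (continuous_apply j).comp ((continuous_apply i).comp M.g_contDiff.continuous)

theorem continuous_ginv : Continuous M.ginv := by
  have hg : Continuous fun p => Matrix.of (M.g p) := M.g_contDiff.continuous
  unfold ginv
  simp only [Matrix.inv_def, Ring.inverse_eq_inv']
  exact (hg.matrix_det.inv₀ M.det_g_ne_zero).smul hg.matrix_adjugate

theorem continuous_christoffel (k i j : Fin n) : Continuous (M.christoffel k i j) := by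
  have hd : ∀ a b c : Fin n,
      Continuous fun p => fderiv ℝ (fun q => M.g q a b) p (Pi.single c 1) := fun a b c =>
    ((contDiff_pi.1 (contDiff_pi.1 M.g_contDiff a) b).continuous_fderiv one_ne_zero).clm_apply
      continuous_const
  have hi : ∀ l, Continuous fun p => M.ginv p k l := fun l => M.continuous_ginv.matrix_elem k l
  unfold christoffel
  exact continuous_const.mul (continuous_finsetSum _ fun l _ =>
    (hi l).mul (((hd _ _ _).add (hd _ _ _)).sub (hd _ _ _)))

/-- The geodesic vector field on phase space. -/
def geodesicField (z : SpacetimePt n × SpacetimePt n) : SpacetimePt n × SpacetimePt n :=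
  (z.2, fun k => -∑ i, ∑ j, M.christoffel k i j z.1 * z.2 i * z.2 j)

theorem continuous_geodesicField : Continuous M.geodesicField := by
  have := M.continuous_christoffel
  unfold geodesicField
  fun_prop

theorem isClosed_causal :
    IsClosed {z : SpacetimePt n × SpacetimePt n | bilForm (M.g z.1) z.2 z.2 ≤ 0} := by
  refine isClosed_le ?_ continuous_const
  have := M.continuous_g_apply
  unfold bilForm
  exact continuous_finsetSum _ fun i _ => continuous_finsetSum _ fun j _ =>
    (((this i j).comp continuous_fst).mul (by fun_prop)).mul (by fun_prop)

variable {M}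

theorem IsGeodesicOn.isSolOn {γ : ℝ → SpacetimePt n} {T : ℝ} (hT : 0 < T)
    (h : M.IsGeodesicOn γ (Icc 0 T)) :
    IsSolOn M.geodesicField (fun t => (γ t, derivWithin γ (Icc 0 T) t)) T := by
  have hU := uniqueDiffOn_Icc hT
  intro t ht
  have h1 := (h.1.differentiableOn two_ne_zero t ht).hasDerivWithinAt
  have h2 : DifferentiableOn ℝ (derivWithin γ (Icc 0 T)) (Icc 0 T) :=
    (h.1.derivWithin (m := 1) hU (by norm_num)).differentiableOn one_ne_zero
  refine h1.prodMk (hasDerivWithinAt_pi.2 fun k => ?_)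
  have h3 : DifferentiableWithinAt ℝ (fun s => derivWithin γ (Icc 0 T) s k) (Icc 0 T) t :=
    differentiableWithinAt_pi.1 (h2 t ht) k
  convert h3.hasDerivWithinAt using 1
  exact (eq_neg_of_add_eq_zero_left (h.2 t ht k)).symm

theorem derivWithin_fst_of_isSolOn {z : ℝ → SpacetimePt n × SpacetimePt n} {T : ℝ} (hT : 0 < T)
    (h : IsSolOn M.geodesicField z T) {t : ℝ} (ht : t ∈ Icc 0 T) :
    derivWithin (fun s => (z s).1) (Icc 0 T) t = (z t).2 :=
  (hasDerivWithinAt_fst_comp (h t ht)).derivWithin (uniqueDiffOn_Icc hT t ht)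

theorem isGeodesicOn_of_isSolOn {z : ℝ → SpacetimePt n × SpacetimePt n} {T : ℝ} (hT : 0 < T)
    (h : IsSolOn M.geodesicField z T) : M.IsGeodesicOn (fun t => (z t).1) (Icc 0 T) := by
  have hU := uniqueDiffOn_Icc hT
  have hw : EqOn (derivWithin (fun s => (z s).1) (Icc 0 T)) (fun t => (z t).2) (Icc 0 T) :=
    fun t ht => derivWithin_fst_of_isSolOn hT h ht
  have hw' : ∀ t ∈ Icc 0 T, HasDerivWithinAt (fun s => (z s).2)
    (M.geodesicField (z t)).2 (Icc 0 T) t := fun t ht => hasDerivWithinAt_snd_comp (h t ht)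
  have hz : ContinuousOn z (Icc 0 T) := fun t ht => (h t ht).continuousWithinAt
  refine ⟨?_, fun t ht k => ?_⟩
  · rw [show (2 : WithTop ℕ∞) = 1 + 1 by norm_num, contDiffOn_succ_iff_derivWithin hU]
    refine ⟨fun t ht => (hasDerivWithinAt_fst_comp (h t ht)).differentiableWithinAt, by simp, ?_⟩
    refine ContDiffOn.congr ?_ hw
    rw [contDiffOn_one_iff_derivWithin hU]
    refine ⟨fun t ht => (hw' t ht).differentiableWithinAt, ?_⟩
    exact ((continuous_snd.comp M.continuous_geodesicField).comp_continuousOn hz).congr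
      fun t ht => (hw' t ht).derivWithin (hU t ht)
  · have h1 : derivWithin (fun s => derivWithin (fun s => (z s).1) (Icc 0 T) s k) (Icc 0 T) t =
        (M.geodesicField (z t)).2 k := by
      rw [derivWithin_congr (f := fun s => (z s).2 k) (fun s hs => congrFun (hw hs) k)
        (congrFun (hw ht) k)]
      exact (hasDerivWithinAt_pi.1 (hw' t ht) k).derivWithin (hU t ht)
    rw [h1, hw ht]
    exact neg_add_cancel _

/-- Affine reparametrization of a solution of the geodesic equation to the unit interval. -/
theorem isSolOn_rescale {z : ℝ → SpacetimePt n × SpacetimePt n} {T s : ℝ}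
    (h : IsSolOn M.geodesicField z T) (hs : s ∈ Ioc 0 T) :
    IsSolOn M.geodesicField (fun t => ((z (s * t)).1, s • (z (s * t)).2)) 1 := by
  intro t ht
  have hmaps : MapsTo (fun t => s * t) (Icc 0 1) (Icc 0 T) := fun u hu =>
    ⟨mul_nonneg hs.1.le hu.1, (mul_le_of_le_one_right hs.1.le hu.2).trans hs.2⟩
  have hmul : HasDerivWithinAt (fun t => s * t) s (Icc 0 1) t := by
    simpa using (hasDerivWithinAt_id t (Icc 0 1)).const_mul s
  have hc := (h (s * t) (hmaps ht)).scomp t hmul hmaps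
  have h2 := (hasDerivWithinAt_fst_comp hc).prodMk ((hasDerivWithinAt_snd_comp hc).const_smul s)
  refine h2.congr_deriv (Prod.ext rfl ?_)
  funext k
  simp only [geodesicField, Prod.smul_mk, Pi.smul_apply, smul_eq_mul, mul_neg, Finset.mul_sum]
  refine congrArg Neg.neg (Finset.sum_congr rfl fun i _ => Finset.sum_congr rfl fun j _ => ?_)
  ring

theorem bilForm_smul_smul (g : Fin n → Fin n → ℝ) (s : ℝ) (v : Fin n → ℝ) :
    bilForm g (s • v) (s • v) = s ^ 2 * bilForm g v v := by
  simp only [bilForm, Pi.smul_apply, smul_eq_mul, Finset.mul_sum]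
  refine Finset.sum_congr rfl fun i _ => Finset.sum_congr rfl fun j _ => ?_
  ring

theorem CausalVec.smul {p v : SpacetimePt n} (h : M.CausalVec p v) {s : ℝ} (hs : 0 < s) :
    M.CausalVec p (s • v) := by
  refine ⟨smul_ne_zero hs.ne' h.1, ?_⟩
  rw [bilForm_smul_smul]
  exact mul_nonpos_of_nonneg_of_nonpos (sq_nonneg s) h.2

/-- Any function with the defining property of the exponential map recovers a causal geodesic,
given as a phase-space solution on `[0, T]`, from its initial velocity. -/
theorem exp_smul_eq {p : SpacetimePt n} {e : SpacetimePt n → SpacetimePt n}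
    (he : ∀ v ∈ M.ExpDomain p, ∀ γ : ℝ → SpacetimePt n,
      M.IsCausalGeodesicOn γ (Set.Icc 0 1) → γ 0 = p →
      derivWithin γ (Set.Icc 0 1) 0 = v → e v = γ 1)
    {z : ℝ → SpacetimePt n × SpacetimePt n} {T s : ℝ} (h : IsSolOn M.geodesicField z T)
    (hz : ∀ t ∈ Icc 0 T, M.CausalVec (z t).1 (z t).2) (h0 : (z 0).1 = p) (hs : s ∈ Ioc 0 T) :
    e (s • (z 0).2) = (z s).1 := by
  have hr := isSolOn_rescale h hs
  have hcausal : M.IsCausalGeodesicOn (fun t => (z (s * t)).1) (Icc 0 1) := by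
    have hgeo := isGeodesicOn_of_isSolOn one_pos hr
    refine ⟨hgeo, fun t ht => ?_⟩
    rw [derivWithin_fst_of_isSolOn one_pos hr ht]
    exact (hz (s * t) ⟨mul_nonneg hs.1.le ht.1,
      (mul_le_of_le_one_right hs.1.le ht.2).trans hs.2⟩).smul hs.1
  have hd : derivWithin (fun t => (z (s * t)).1) (Icc 0 1) 0 = s • (z 0).2 := by
    simpa using derivWithin_fst_of_isSolOn one_pos hr (left_mem_Icc.2 zero_le_one)
  have h0' : (fun t => (z (s * t)).1) 0 = p := by simpa using h0
  have hc := (hz 0 ⟨le_rfl, hs.1.le.trans hs.2⟩).smul hs.1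
  rw [h0] at hc
  simpa using he _ ⟨hc.2, _, hcausal, h0', hd⟩ _ hcausal h0' hd

/-- Two causal phase-space solutions with the same initial value agree. -/
theorem isSolOn_unique {p : SpacetimePt n} {e : SpacetimePt n → SpacetimePt n}
    (he : ∀ v ∈ M.ExpDomain p, ∀ γ : ℝ → SpacetimePt n,
      M.IsCausalGeodesicOn γ (Set.Icc 0 1) → γ 0 = p →
      derivWithin γ (Set.Icc 0 1) 0 = v → e v = γ 1)
    {z z' : ℝ → SpacetimePt n × SpacetimePt n} {T : ℝ} (hT : 0 < T)
    (h : IsSolOn M.geodesicField z T) (h' : IsSolOn M.geodesicField z' T)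
    (hz : ∀ t ∈ Icc 0 T, M.CausalVec (z t).1 (z t).2)
    (hz' : ∀ t ∈ Icc 0 T, M.CausalVec (z' t).1 (z' t).2)
    (h0 : (z 0).1 = p) (h00 : z 0 = z' 0) : z T = z' T := by
  have hpos : EqOn (fun t => (z t).1) (fun t => (z' t).1) (Icc 0 T) := by
    intro t ht
    rcases ht.1.eq_or_lt with rfl | ht0
    · exact congrArg Prod.fst h00
    · have h1 := exp_smul_eq he h hz h0 ⟨ht0, ht.2⟩
      rw [h00] at h1
      exact h1.symm.trans (exp_smul_eq he h' hz' (h00 ▸ h0) ⟨ht0, ht.2⟩)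
  have hTT : T ∈ Icc 0 T := ⟨hT.le, le_rfl⟩
  refine Prod.ext (hpos hTT) ?_
  rw [← derivWithin_fst_of_isSolOn hT h hTT, ← derivWithin_fst_of_isSolOn hT h' hTT]
  exact derivWithin_congr hpos (hpos hTT)

end C1Spacetime

open C1Spacetime in
/-- Proposition 4.9: in a causally non-branching, non-intertwining C¹-spacetime,
the causal exponential map at any point is continuous on its domain. Here `e` is any
function satisfying the defining property of the causal exponential map. -/
theorem causal_exp_continuous
    {n : ℕ} (hn : 2 ≤ n) (M : C1Spacetime n)
    (hnb : M.CausallyNonBranching) (hni : M.NonIntertwining)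
    (p : SpacetimePt n) (e : SpacetimePt n → SpacetimePt n)
    (he : ∀ v ∈ M.ExpDomain p, ∀ γ : ℝ → SpacetimePt n,
      M.IsCausalGeodesicOn γ (Set.Icc 0 1) → γ 0 = p →
      derivWithin γ (Set.Icc 0 1) 0 = v → e v = γ 1) :
    ContinuousOn e (M.ExpDomain p) := by
  rw [continuousOn_iff_continuous_domRestrict, continuous_iff_ultrafilter]
  intro v U hU
  choose γ hγ hγ0 hγv using fun u : M.ExpDomain p => u.2.2
  set y : M.ExpDomain p → ℝ → SpacetimePt n × SpacetimePt n :=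
    fun u t => (γ u t, derivWithin (γ u) (Icc 0 1) t)
  have hy : ∀ u, IsSolOn M.geodesicField (y u) 1 := fun u => (hγ u).1.isSolOn one_pos
  have hy0 : ∀ u, y u 0 = (p, (u : SpacetimePt n)) := fun u => Prod.ext (hγ0 u) (hγv u)
  have he1 : ∀ u : M.ExpDomain p, e u = (y u 1).1 := fun u =>
    he u u.2 (γ u) (hγ u) (hγ0 u) (hγv u)
  have hcont : ContinuousOn (y v) (Icc 0 1) := fun t ht => (hy v t ht).continuousWithinAt
  obtain ⟨t₀, ht₀, hmin⟩ := isCompact_Icc.exists_isMinOn (nonempty_Icc.2 zero_le_one)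
    (continuous_snd.comp_continuousOn hcont).norm
  have hr : 0 < ‖(y v t₀).2‖ := norm_pos_iff.2 ((hγ v).2 t₀ ht₀).1
  have hlim := tendsto_solution_of_unique U M.continuous_geodesicField M.isClosed_causal hcont hy
    (fun u t ht => ((hγ u).2 t ht).2)
    (by simp only [hy0]
        exact tendsto_const_nhds.prodMk_nhds ((continuous_subtype_val.tendsto v).mono_left hU))
    (half_pos hr)
    (fun T hT z hz hzC h0 => by
      refine isSolOn_unique he hT.1 hz ((hy v).mono hT.2) (fun t ht => ⟨?_, (hzC t ht).1⟩)
        (fun t ht => (hγ v).2 t ⟨ht.1, ht.2.trans hT.2⟩) (by rw [h0, hy0]) h0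
      intro hzero
      have h1 : dist (z t).2 (y v t).2 ≤ ‖(y v t₀).2‖ / 2 :=
        (le_max_right _ _).trans (hzC t ht).2
      rw [hzero, dist_zero_left] at h1
      have h2 : ‖(y v t₀).2‖ ≤ ‖(y v t).2‖ := hmin ⟨ht.1, ht.2.trans hT.2⟩
      linarith)
  have heq : (M.ExpDomain p).domRestrict e = fun u => (y u 1).1 := funext he1
  rw [heq]
  exact (continuous_fst.tendsto _).comp hlim
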